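/- arXiv:2001.09597 — 2 statements merged into one kernel-verified Lean document; each statement's English description precedes it below -/
import Mathlib

section
/- Let p be a prime, k ≥ 1 an integer, and Ω a set of size p^k. Then every Sylow p-subgroup P of Sym(Ω) is 2-closed on Ω, i.e., P = P^{(2),Ω}. -/
def twoClosure {Ω : Type*} (H : Subgroup (Equiv.Perm Ω)) : Subgroup (Equiv.Perm Ω) where
  carrier := {θ | ∀ α β : Ω, ∃ h ∈ H, θ α = h α ∧ θ β = h β}
  one_mem' := fun α β => ⟨1, H.one_mem, rfl, rfl⟩
  mul_mem' := by
    intro a b ha hb α β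
    obtain ⟨h₂, h₂H, e1, e2⟩ := hb α β
    obtain ⟨h₁, h₁H, f1, f2⟩ := ha (b α) (b β)
    refine ⟨h₁ * h₂, H.mul_mem h₁H h₂H, ?_, ?_⟩
    · simp only [Equiv.Perm.mul_apply]; rw [f1, e1]
    · simp only [Equiv.Perm.mul_apply]; rw [f2, e2]
  inv_mem' := by
    intro a ha α β
    obtain ⟨h, hH, e1, e2⟩ := ha (a⁻¹ α) (a⁻¹ β)
    refine ⟨h⁻¹, H.inv_mem hH, ?_, ?_⟩
    · have h1 : h (a⁻¹ α) = α := by rw [← e1]; simp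
      exact Equiv.Perm.eq_inv_iff_eq.mpr h1
    · have h2 : h (a⁻¹ β) = β := by rw [← e2]; simp
      exact Equiv.Perm.eq_inv_iff_eq.mpr h2

def IsTotally2Closed (G : Type*) [Group G] : Prop :=
  ∀ (Ω : Type*) (H : Subgroup (Equiv.Perm Ω)), Nonempty (G ≃* H) → twoClosure H = H

def IsGeneralizedQuaternion (Q : Type*) [Group Q] : Prop :=
  ∃ m : ℕ, 1 ≤ m ∧ Nonempty (Q ≃* QuaternionGroup (2 ^ m))

def IsFittingSubgroup {G : Type*} [Group G] (F : Subgroup G) : Prop :=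
  F.Normal ∧ Group.IsNilpotent F ∧
    ∀ N : Subgroup G, N.Normal → Group.IsNilpotent N → N ≤ F

def IsMinimalNormal {X : Type*} [Group X] (M : Subgroup X) : Prop :=
  M.Normal ∧ M ≠ ⊥ ∧ ∀ N : Subgroup X, N.Normal → N ≤ M → N = ⊥ ∨ N = M

theorem twoClosure_step {Ω : Type*} (H : Subgroup (Equiv.Perm Ω)) (N M : Subgroup H) [N.Normal]
    (hNM : ∀ z ∈ M, ∀ g : H, z * g * z⁻¹ * g⁻¹ ∈ N) (q : ℕ) (hq : ∀ z : H, z ^ q = 1)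
    (θ : Equiv.Perm Ω) (hθ : θ ∈ twoClosure H)
    (h : ∀ α, ∃ z ∈ M, θ α = (z : Equiv.Perm Ω) α) :
    ∀ α, ∃ z ∈ N, (θ ^ q) α = (z : Equiv.Perm Ω) α := by
  intro α
  obtain ⟨z, hz, e⟩ := h α
  have inv : ∀ a b, (∃ n ∈ N, b = ((n * z : H) : Equiv.Perm Ω) a) →
      ∃ n ∈ N, θ b = ((n * z : H) : Equiv.Perm Ω) (θ a) := by
    rintro a b ⟨n, hn, rfl⟩
    obtain ⟨g, hg, e1, e2⟩ := hθ a (((n * z : H) : Equiv.Perm Ω) a)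
    let g' : H := ⟨g, hg⟩
    refine ⟨(g' * n * g'⁻¹) * (z * g' * z⁻¹ * g'⁻¹)⁻¹, N.mul_mem
      (Subgroup.Normal.conj_mem inferInstance n hn g') (N.inv_mem (hNM z hz g')), ?_⟩
    rw [e2, e1]
    have : (g' * n * g'⁻¹) * (z * g' * z⁻¹ * g'⁻¹)⁻¹ * z = g' * (n * z) * g'⁻¹ := by group
    rw [this]
    simp [g', Equiv.Perm.mul_apply]
  have step : ∀ j : ℕ, ∃ n ∈ N, (θ ^ (j+1)) α = ((n * z : H) : Equiv.Perm Ω) ((θ ^ j) α) := by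
    intro j
    induction j with
    | zero => exact ⟨1, N.one_mem, by simpa using e⟩
    | succ j ih =>
      have := inv _ _ ih
      rw [pow_succ' θ (j+1), pow_succ' θ j]
      rw [pow_succ' θ j] at this
      simpa only [Equiv.Perm.mul_apply] using this
  have key : ∀ j : ℕ, ∃ n ∈ N, (θ ^ j) α = ((n * z ^ j : H) : Equiv.Perm Ω) α := by
    intro j
    induction j with
    | zero => exact ⟨1, N.one_mem, by simp⟩
    | succ j ih =>
      obtain ⟨n, hn, e1⟩ := ih
      obtain ⟨n', hn', e2⟩ := step j
      refine ⟨n' * (z * n * z⁻¹), N.mul_mem hn'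
        (Subgroup.Normal.conj_mem inferInstance n hn z), ?_⟩
      have : n' * (z * n * z⁻¹) * z ^ (j+1) = (n' * z) * (n * z ^ j) := by
        rw [pow_succ']; group
      rw [this, e2, e1, Subgroup.coe_mul H (n' * z), Equiv.Perm.mul_apply]
  obtain ⟨n, hn, e1⟩ := key q
  exact ⟨n, hn, by simpa [hq] using e1⟩

theorem twoClosure_isPGroup {Ω : Type*} [Finite Ω] (p : ℕ) [Fact p.Prime]
    (H : Subgroup (Equiv.Perm Ω)) (hH : IsPGroup p H) : IsPGroup p (twoClosure H) := by
  obtain ⟨e, he⟩ := IsPGroup.iff_card.mp hH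
  have hq : ∀ z : H, z ^ (p ^ e) = 1 := fun z => by rw [← he]; exact pow_card_eq_one'
  have hn : Group.IsNilpotent H := hH.isNilpotent
  obtain ⟨n, hn⟩ := hn.nilpotent'
  rintro ⟨θ, hθ⟩
  have key : ∀ i, i ≤ n → ∃ m : ℕ, ∀ α, ∃ z ∈ Subgroup.upperCentralSeries H (n - i),
      (θ ^ (p ^ m)) α = (z : Equiv.Perm Ω) α := by
    intro i
    induction i with
    | zero =>
      intro _
      refine ⟨0, fun α => ?_⟩
      obtain ⟨g, hg, e1, -⟩ := hθ α α
      exact ⟨⟨g, hg⟩, by simp [hn], by simpa using e1⟩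
    | succ i ih =>
      intro hi
      obtain ⟨m, hm⟩ := ih (by omega)
      refine ⟨m + e, ?_⟩
      rw [pow_add, pow_mul]
      refine twoClosure_step H _ (Subgroup.upperCentralSeries H (n - i)) ?_ _ hq _
        ((twoClosure H).pow_mem hθ _) hm
      intro z hz g
      rw [show n - i = (n - (i+1)) + 1 by omega] at hz
      exact Subgroup.mem_upperCentralSeries_succ_iff.mp hz g
  obtain ⟨m, hm⟩ := key n le_rfl
  refine ⟨m, Subtype.ext (Equiv.ext fun α => ?_)⟩
  obtain ⟨z, hz, e1⟩ := hm α
  simp at hz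
  subst hz
  simpa using e1

theorem sylow_of_perm_is_two_closed
    {Ω : Type*} [Fintype Ω] (p k : ℕ) [Fact p.Prime] (hk : 1 ≤ k)
    (hcard : Fintype.card Ω = p ^ k) (P : Sylow p (Equiv.Perm Ω)) :
    twoClosure (P : Subgroup (Equiv.Perm Ω)) = (P : Subgroup (Equiv.Perm Ω)) := by
  exact P.is_maximal' (twoClosure_isPGroup p _ P.isPGroup')
    (fun g hg α β => ⟨g, hg, rfl, rfl⟩)
end

section
/- Let Ω be a finite set and let G ≤ Sym(Ω) satisfy G = G^{(2),Ω}. Then the Fitting subgroup F(G) of G satisfies F(G) = F(G)^{(2),Ω}. -/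
theorem aux_commute {G : Type*} [Group G] [Group.IsNilpotent G] :
    ∀ (x y : G) (c r : ℕ), Nat.Coprime c r → x ^ c = 1 → y ^ r = 1 → Commute x y := by
  refine Group.nilpotent_center_quotient_ind
    (P := fun G _ _ => ∀ (x y : G) (c r : ℕ), Nat.Coprime c r → x ^ c = 1 → y ^ r = 1 →
      Commute x y) G ?_ ?_
  · intro G _ _ x y c r _ _ _
    exact Subsingleton.elim _ _
  · intro G _ _ ih x y c r hcr hx hy
    have h := ih (x : G ⧸ Subgroup.center G) (y : G ⧸ Subgroup.center G) c r hcr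
      (by rw [← QuotientGroup.mk_pow, hx]; rfl) (by rw [← QuotientGroup.mk_pow, hy]; rfl)
    have hz : x * y * x⁻¹ * y⁻¹ ∈ Subgroup.center G := by
      rw [← QuotientGroup.eq_one_iff]
      simp only [QuotientGroup.mk_mul, QuotientGroup.mk_inv]
      rw [h.eq]; group
    obtain ⟨z, hzd⟩ : ∃ z, z = x * y * x⁻¹ * y⁻¹ := ⟨_, rfl⟩
    rw [← hzd] at hz
    have hc : ∀ g, Commute z g := fun g => ((Subgroup.mem_center_iff.mp hz) g).symm
    have h1 : z * y = x * y * x⁻¹ := by rw [hzd]; group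
    have h2 : z⁻¹ * x = y * x * y⁻¹ := by
      have : z * (y * x * y⁻¹) = x := by rw [hzd]; group
      rw [inv_mul_eq_iff_eq_mul]; exact this.symm
    have e1 : z ^ r = 1 := by
      have := congrArg (· ^ r) h1
      simp only [(hc y).mul_pow, conj_pow, hy] at this
      simpa using this
    have e2 : z ^ c = 1 := by
      have := congrArg (· ^ c) h2
      simp only [((hc x).inv_left).mul_pow, conj_pow, hx] at this
      simpa using this
    have e3 : z = 1 := by
      rw [← orderOf_eq_one_iff]
      exact Nat.eq_one_of_dvd_coprimes hcr (orderOf_dvd_of_pow_eq_one e2)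
        (orderOf_dvd_of_pow_eq_one e1)
    rw [e3, one_mul] at h1
    show x * y = y * x
    exact (eq_mul_inv_iff_mul_eq.mp h1).symm

def PairLike (F : Type*) {X : Type*} [Group F] [MulAction F X] (θ : Equiv.Perm X) : Prop :=
  ∀ α β : X, ∃ h : F, θ α = h • α ∧ θ β = h • β

theorem PairLike.pow {F X : Type*} [Group F] [MulAction F X] {θ : Equiv.Perm X}
    (hθ : PairLike F θ) (n : ℕ) : PairLike F (θ ^ n) := by
  induction n with
  | zero => intro α β; exact ⟨1, by simp, by simp⟩
  | succ n ih =>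
    intro α β
    obtain ⟨h, h1, h2⟩ := ih α β
    obtain ⟨k, k1, k2⟩ := hθ ((θ ^ n) α) ((θ ^ n) β)
    refine ⟨k * h, ?_, ?_⟩
    · rw [pow_succ', Equiv.Perm.mul_apply, k1, h1, mul_smul]
    · rw [pow_succ', Equiv.Perm.mul_apply, k2, h2, mul_smul]

theorem aux_step {F X : Type*} [Group F] [MulAction F X] {θ : Equiv.Perm X}
    (hθ : PairLike F θ) (A B : Subgroup F) (hA : A.Normal)
    (hAB : ∀ z ∈ B, ∀ h : F, h * z * h⁻¹ * z⁻¹ ∈ A) (m : ℕ) (hm : ∀ z ∈ B, z ^ m ∈ A)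
    (hB : ∀ α : X, ∃ z ∈ B, θ α = z • α) (α : X) : ∃ z ∈ A, (θ ^ m) α = z • α := by
  obtain ⟨z, hz, hzα⟩ := hB α
  have key : ∀ k : ℕ, ∃ w ∈ A, (θ ^ k) α = (w * z ^ k) • α := by
    intro k
    induction k with
    | zero => exact ⟨1, A.one_mem, by simp⟩
    | succ k ih =>
      obtain ⟨w, hw, hwα⟩ := ih
      obtain ⟨h, h1, h2⟩ := hθ α ((w * z ^ k) • α)
      refine ⟨(h * w * h⁻¹) * (h * z ^ k * h⁻¹ * (z ^ k)⁻¹),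
        A.mul_mem (hA.conj_mem _ hw _) (hAB _ (B.pow_mem hz k) h), ?_⟩
      rw [pow_succ', Equiv.Perm.mul_apply, hwα, h2]
      have h3 : h • α = z • α := h1.symm.trans hzα
      calc h • (w * z ^ k) • α = (h * w * z ^ k * h⁻¹) • (h • α) := by
            rw [smul_smul, smul_smul]; congr 1; group
        _ = _ := by
            rw [h3, smul_smul]; congr 1; rw [pow_succ]; group
  obtain ⟨w, hw, e⟩ := key m
  exact ⟨w * z ^ m, A.mul_mem hw (hm z hz), e⟩

theorem aux_sup {F : Type*} [Group F] (N : Subgroup F) (hN : N.Normal) (i : ℕ) :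
    ∀ z ∈ N ⊔ Subgroup.upperCentralSeries F (i + 1), ∀ h : F,
      h * z * h⁻¹ * z⁻¹ ∈ N ⊔ Subgroup.upperCentralSeries F i := by
  intro z hz h
  obtain ⟨n, hn, w, hw, rfl⟩ := Subgroup.mem_sup_of_normal_left.mp hz
  have hw' : h * w * h⁻¹ * w⁻¹ ∈ Subgroup.upperCentralSeries F i := by
    have := Subgroup.mem_upperCentralSeries_succ_iff.mp hw h
    have := inv_mem this
    rw [commutatorElement_inv, commutatorElement_def] at this
    exact this
  have e : h * (n * w) * h⁻¹ * (n * w)⁻¹ = (h * n * h⁻¹) * (h * w * h⁻¹ * w⁻¹) * n⁻¹ := by group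
  rw [e]
  exact mul_mem (mul_mem (Subgroup.mem_sup_left (hN.conj_mem _ hn _)) (Subgroup.mem_sup_right hw'))
    (Subgroup.mem_sup_left (inv_mem hn))

theorem aux_orbits {F X : Type*} [Group F] [Group.IsNilpotent F] [MulAction F X]
    {θ : Equiv.Perm X} (hθ : PairLike F θ) (N : Subgroup F) (hN : N.Normal) (m : ℕ)
    (hm : ∀ z : F, z ^ m ∈ N) : ∃ n : ℕ, ∀ α : X, ∃ z ∈ N, (θ ^ (m ^ n)) α = z • α := by
  obtain ⟨n, hn⟩ := Group.IsNilpotent.nilpotent F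
  refine ⟨n, ?_⟩
  have key : ∀ j i : ℕ, i + j = n → ∀ α : X,
      ∃ z ∈ N ⊔ Subgroup.upperCentralSeries F i, (θ ^ (m ^ j)) α = z • α := by
    intro j
    induction j with
    | zero =>
      intro i hi α
      obtain ⟨h, h1, -⟩ := hθ α α
      have : i = n := by omega
      refine ⟨h, ?_, by simpa using h1⟩
      rw [this, hn]; simp
    | succ j ih =>
      intro i hi α
      rw [pow_succ, pow_mul]
      exact aux_step (hθ.pow (m ^ j)) _ _ inferInstance (aux_sup N hN i) m
        (fun z _ => Subgroup.mem_sup_left (hm z)) (ih (i + 1) (by omega)) α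
  intro α
  obtain ⟨z, hz, e⟩ := key n 0 (by omega) α
  rw [Subgroup.upperCentralSeries_zero, sup_bot_eq] at hz
  exact ⟨z, hz, e⟩

theorem aux_smul_pow {F X : Type*} [Group F] [MulAction F X] (N : Subgroup F)
    {θ : Equiv.Perm X} (h : ∀ α : X, ∃ z ∈ N, θ α = z • α) (k : ℕ) (α : X) :
    ∃ z ∈ N, (θ ^ k) α = z • α := by
  induction k with
  | zero => exact ⟨1, N.one_mem, by simp⟩
  | succ k ih =>
    obtain ⟨z, hz, e⟩ := ih
    obtain ⟨w, hw, e'⟩ := h ((θ ^ k) α)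
    exact ⟨w * z, N.mul_mem hw hz, by rw [pow_succ', Equiv.Perm.mul_apply, e', e, mul_smul]⟩

theorem aux_fix {F X : Type*} [Group F] [MulAction F X] {y u : F} (hc : Commute y u) {α : X}
    (h : y • α = u • α) {c r : ℕ} (hcr : Nat.Coprime c r) (hy : y ^ r = 1) (hu : u ^ c = 1) :
    y • α = α := by
  have h1 : u⁻¹ * y ∈ MulAction.stabilizer F α := by
    rw [MulAction.mem_stabilizer_iff, mul_smul, h, inv_smul_smul]
  have h2 := Subgroup.pow_mem _ h1 c
  rw [(hc.symm.inv_left).mul_pow, inv_pow, hu, inv_one, one_mul] at h2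
  have hco : Nat.Coprime c (orderOf y) := hcr.coprime_dvd_right (orderOf_dvd_of_pow_eq_one hy)
  obtain ⟨k, hk⟩ := exists_pow_eq_self_of_coprime hco
  have h3 := Subgroup.pow_mem _ h2 k
  rw [hk] at h3
  exact h3

theorem aux_conj_smul {F X : Type*} [Group F] [MulAction F X] (N : Subgroup F) (hN : N.Normal)
    {h : F} {α : X} (hα : ∃ u ∈ N, h • α = u • α) (k : ℤ) : ∃ u ∈ N, (h ^ k) • α = u • α := by
  have h1 : h ∈ N ⊔ MulAction.stabilizer F α := by
    obtain ⟨u, hu, e⟩ := hα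
    have : u⁻¹ * h ∈ MulAction.stabilizer F α := by
      rw [MulAction.mem_stabilizer_iff, mul_smul, e, inv_smul_smul]
    have := mul_mem (Subgroup.mem_sup_left hu) (Subgroup.mem_sup_right (S := N) this)
    simpa using this
  obtain ⟨u, hu, s, hs, e⟩ := Subgroup.mem_sup_of_normal_left.mp (Subgroup.zpow_mem _ h1 k)
  refine ⟨u, hu, ?_⟩
  rw [← e, mul_smul, MulAction.mem_stabilizer_iff.mp hs]

theorem aux_sylow {F X : Type*} [Group F] [Finite F] [Group.IsNilpotent F] [MulAction F X]
    (p : ℕ) [hp : Fact p.Prime] (P : Sylow p F) {θ : Equiv.Perm X} (hθ : PairLike F θ)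
    (a : ℕ) (hpθ : θ ^ (p ^ a) = 1) (α β : X) :
    ∃ x ∈ P.toSubgroup, θ α = x • α ∧ θ β = x • β := by
  have hN : P.toSubgroup.Normal :=
    (Group.isNilpotent_of_finite_tfae (G := F)).out 0 3 rfl rfl |>.mp ‹_› p ‹_› P
  obtain ⟨b, hb⟩ := P.isPGroup'.exists_card_eq
  have hr : Nat.Coprime p P.toSubgroup.index :=
    (Nat.Prime.coprime_iff_not_dvd hp.out).mpr P.not_dvd_index
  have hpow : ∀ z : F, z ^ P.toSubgroup.index ∈ P.toSubgroup := fun z =>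
    Subgroup.pow_index_mem P.toSubgroup z
  obtain ⟨n, hn⟩ := aux_orbits hθ P.toSubgroup hN _ hpow
  have hco : Nat.Coprime (P.toSubgroup.index ^ n) (orderOf θ) :=
    ((hr.pow a n).symm).coprime_dvd_right (orderOf_dvd_of_pow_eq_one hpθ)
  obtain ⟨k, hk⟩ := exists_pow_eq_self_of_coprime hco
  have horb : ∀ γ : X, ∃ z ∈ P.toSubgroup, θ γ = z • γ := by
    intro γ
    have := aux_smul_pow P.toSubgroup hn k γ
    rwa [hk] at this
  obtain ⟨h, h1, h2⟩ := hθ α β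
  obtain ⟨r, hrd⟩ : ∃ r, r = P.toSubgroup.index := ⟨_, rfl⟩
  rw [← hrd] at hr hpow
  have hcr : Nat.Coprime (p ^ b) r := hr.pow_left b
  have hcard : p ^ b * r = Nat.card F := by
    rw [hrd, ← hb]; exact Subgroup.card_mul_index _
  have hbez : (1 : ℤ) = r * Nat.gcdB (p ^ b) r + (p ^ b : ℕ) * Nat.gcdA (p ^ b) r := by
    have := Nat.gcd_eq_gcd_ab (p ^ b) r
    rw [hcr.gcd_eq_one] at this
    push_cast at this ⊢
    linarith
  obtain ⟨u, v, huv⟩ : ∃ u v : ℤ, (1 : ℤ) = r * v + (p ^ b : ℕ) * u := ⟨_, _, hbez⟩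
  have hh : h = h ^ ((r : ℤ) * v) * h ^ (((p ^ b : ℕ) : ℤ) * u) := by
    rw [← zpow_add, ← huv, zpow_one]
  have hx : h ^ ((r : ℤ) * v) ∈ P.toSubgroup := by
    rw [zpow_mul, zpow_natCast]; exact Subgroup.zpow_mem _ (hpow h) v
  have hy : (h ^ (((p ^ b : ℕ) : ℤ) * u)) ^ r = 1 := by
    rw [← zpow_natCast, ← zpow_mul, mul_right_comm, ← Nat.cast_mul, hcard, zpow_mul, zpow_natCast,
      pow_card_eq_one', one_zpow]
  have hfix : ∀ γ : X, θ γ = h • γ → (h ^ (((p ^ b : ℕ) : ℤ) * u)) • γ = γ := by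
    intro γ hγ
    obtain ⟨w, hw, e⟩ := aux_conj_smul P.toSubgroup hN (hγ ▸ horb γ) (((p ^ b : ℕ) : ℤ) * u)
    have hwc : w ^ (p ^ b) = 1 := by
      have : (⟨w, hw⟩ : P.toSubgroup) ^ (p ^ b) = 1 := by rw [← hb]; exact pow_card_eq_one'
      simpa using congrArg Subtype.val this
    exact aux_fix (aux_commute w _ _ _ hcr hwc hy).symm e hcr hy hwc
  refine ⟨_, hx, ?_, ?_⟩
  · conv_lhs => rw [h1, hh, mul_smul, hfix α h1]
  · conv_lhs => rw [h2, hh, mul_smul, hfix β h2]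

theorem aux_pairLike {Ω : Type*} {F : Subgroup (Equiv.Perm Ω)} {θ : Equiv.Perm Ω}
    (h : θ ∈ twoClosure F) : PairLike F θ := by
  intro α β
  obtain ⟨g, hg, h1, h2⟩ := h α β
  exact ⟨⟨g, hg⟩, h1, h2⟩

theorem aux_mono {Ω : Type*} {F G : Subgroup (Equiv.Perm Ω)} (h : F ≤ G) :
    twoClosure F ≤ twoClosure G := by
  intro θ hθ α β
  obtain ⟨g, hg, e⟩ := hθ α β
  exact ⟨g, h hg, e⟩

theorem aux_pgroup {Ω : Type*} [Finite Ω] {F : Subgroup (Equiv.Perm Ω)} {p : ℕ} [Fact p.Prime]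
    (hF : IsPGroup p F) {θ : Equiv.Perm Ω} (h : θ ∈ twoClosure F) : ∃ k : ℕ, θ ^ (p ^ k) = 1 := by
  have : Group.IsNilpotent F := hF.isNilpotent
  obtain ⟨b, hb⟩ := hF.exists_card_eq
  obtain ⟨n, hn⟩ := aux_orbits (aux_pairLike h) (⊥ : Subgroup F) inferInstance (p ^ b)
    (fun z => by rw [← hb, pow_card_eq_one']; exact Subgroup.one_mem _)
  refine ⟨b * n, ?_⟩
  ext α
  obtain ⟨z, hz, e⟩ := hn α
  rw [Subgroup.mem_bot.mp hz, one_smul] at e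
  rw [pow_mul, e]; rfl

theorem aux_nilpotent {Ω : Type*} [Finite Ω] (F : Subgroup (Equiv.Perm Ω))
    (hF : Group.IsNilpotent F) : Group.IsNilpotent (twoClosure F) := by
  refine (Group.isNilpotent_of_finite_tfae (G := twoClosure F)).out 0 3 rfl rfl |>.mpr ?_
  intro p hp S
  obtain ⟨P⟩ : Nonempty (Sylow p F) := inferInstance
  have hPp : IsPGroup p (P.toSubgroup.map F.subtype) := P.isPGroup'.map _
  have hmem : ∀ θ : twoClosure F, (∃ k : ℕ, θ ^ (p ^ k) = 1) →
      θ ∈ (twoClosure (P.toSubgroup.map F.subtype)).subgroupOf (twoClosure F) := by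
    rintro θ ⟨k, hk⟩
    rw [Subgroup.mem_subgroupOf]
    intro α β
    obtain ⟨x, hx, h1, h2⟩ := aux_sylow p P (aux_pairLike θ.2) k
      (by simpa using congrArg Subtype.val hk) α β
    exact ⟨x, Subgroup.mem_map_of_mem F.subtype hx, h1, h2⟩
  have hT : IsPGroup p ((twoClosure (P.toSubgroup.map F.subtype)).subgroupOf (twoClosure F)) := by
    rintro ⟨θ, hθ⟩
    obtain ⟨k, hk⟩ := aux_pgroup hPp (Subgroup.mem_subgroupOf.mp hθ)
    exact ⟨k, Subtype.ext (Subtype.ext (by simpa using hk))⟩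
  have hSp : ∀ s ∈ S.toSubgroup, ∃ k : ℕ, s ^ (p ^ k) = 1 := by
    intro s hs
    obtain ⟨k, hk⟩ := S.isPGroup' ⟨s, hs⟩
    exact ⟨k, by simpa using congrArg Subtype.val hk⟩
  have hST := S.is_maximal' hT (fun s hs => hmem s (hSp s hs))
  refine ⟨fun s hs g => ?_⟩
  obtain ⟨k, hk⟩ := hSp s hs
  show _ ∈ S.toSubgroup
  rw [← hST]
  exact hmem _ ⟨k, by rw [conj_pow, hk]; simp⟩

theorem fitting_of_two_closed_is_two_closed
    {Ω : Type*} [Finite Ω] (G : Subgroup (Equiv.Perm Ω))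
    (hG : twoClosure G = G) (F : Subgroup (Equiv.Perm Ω)) (hFG : F ≤ G)
    (hFnorm : (F.subgroupOf G).Normal) (hFnil : Group.IsNilpotent F)
    (hFmax : ∀ M : Subgroup (Equiv.Perm Ω), M ≤ G → (M.subgroupOf G).Normal →
      Group.IsNilpotent M → M ≤ F) :
    twoClosure F = F := by
  refine le_antisymm ?_ (fun g hg α β => ⟨g, hg, rfl, rfl⟩)
  refine hFmax _ (hG ▸ aux_mono hFG) ⟨fun s hs g => ?_⟩ (aux_nilpotent F hFnil)
  rw [Subgroup.mem_subgroupOf] at hs ⊢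
  intro α β
  obtain ⟨h, hh, h1, h2⟩ := hs ((g : Equiv.Perm Ω)⁻¹ α) ((g : Equiv.Perm Ω)⁻¹ β)
  refine ⟨g * h * (g : Equiv.Perm Ω)⁻¹, ?_, ?_, ?_⟩
  · exact hFnorm.conj_mem ⟨h, hFG hh⟩ hh g
  · simpa using h1
  · simpa using h2
end
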